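/- Let k ≥ 6 be even and n > (5/4)k² + 2k. Then in GP(n,k), for the vertices u_0 and v_{n-k} (which are at distance 2), 2|W_{v_{n-k} u_0}| + |_{u_0}W_{v_{n-k}}| ≥ 2n + n/k − (5/4)k − 2 > 2n. -/

import Mathlib

/-- The generalized Petersen graph `GP(n,k)`: vertices are `Sum.inl i` (the outer
vertices `u_i`) and `Sum.inr i` (the inner vertices `v_i`) for `i ∈ ZMod n`, with
edges `u_i u_{i+1}`, `v_i v_{i+k}` and spokes `u_i v_i`. -/
def genPetersen (n k : ℕ) : SimpleGraph (ZMod n ⊕ ZMod n) :=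
  SimpleGraph.fromRel (fun x y =>
    match x, y with
    | Sum.inl i, Sum.inl j => j = i + 1
    | Sum.inr i, Sum.inr j => j = i + (k : ZMod n)
    | Sum.inl i, Sum.inr j => i = j
    | _, _ => False)

/-- `W_{xy}`: the set of vertices strictly closer to `x` than to `y`. -/
def closerSet {V : Type*} (G : SimpleGraph V) (x y : V) : Set V :=
  {w | G.dist w x < G.dist w y}

/-- `_xW_y`: the set of vertices equidistant from `x` and `y`. -/
def eqDistSet {V : Type*} (G : SimpleGraph V) (x y : V) : Set V :=
  {w | G.dist w x = G.dist w y}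

/-- A graph is `ℓ`-distance-balanced if every pair of vertices at distance `ℓ`
is balanced. -/
def IsLDistBalanced {V : Type*} (G : SimpleGraph V) (ℓ : ℕ) : Prop :=
  ∀ x y : V, G.dist x y = ℓ → (closerSet G x y).ncard = (closerSet G y x).ncard

/-- A graph is distance-balanced if every pair of adjacent vertices is balanced. -/
def IsDistBalanced {V : Type*} (G : SimpleGraph V) : Prop :=
  ∀ x y : V, G.Adj x y → (closerSet G x y).ncard = (closerSet G y x).ncard

namespace GPaux

/-- There is a walk of length at most `m`. -/
def RW {V : Type*} (G : SimpleGraph V) (m : ℕ) (x y : V) : Prop :=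
  ∃ p : G.Walk x y, p.length ≤ m

theorem RW.refl {V : Type*} (G : SimpleGraph V) (x : V) : RW G 0 x x :=
  ⟨SimpleGraph.Walk.nil, by simp⟩

theorem RW.trans {V : Type*} {G : SimpleGraph V} {m m' : ℕ} {x y z : V}
    (h : RW G m x y) (h' : RW G m' y z) : RW G (m + m') x z := by
  obtain ⟨p, hp⟩ := h
  obtain ⟨q, hq⟩ := h'
  exact ⟨p.append q, by rw [SimpleGraph.Walk.length_append]; omega⟩

theorem RW.symm {V : Type*} {G : SimpleGraph V} {m : ℕ} {x y : V}
    (h : RW G m x y) : RW G m y x := by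
  obtain ⟨p, hp⟩ := h
  exact ⟨p.reverse, by rw [SimpleGraph.Walk.length_reverse]; omega⟩

theorem RW.of_adj {V : Type*} {G : SimpleGraph V} {x y : V}
    (h : G.Adj x y) : RW G 1 x y := ⟨h.toWalk, by simp⟩

theorem RW.dist_le {V : Type*} {G : SimpleGraph V} {m : ℕ} {x y : V}
    (h : RW G m x y) : G.dist x y ≤ m := by
  obtain ⟨p, hp⟩ := h
  exact (SimpleGraph.dist_le p).trans hp

theorem adj_uv (n k : ℕ) (i : ZMod n) : (genPetersen n k).Adj (Sum.inl i) (Sum.inr i) := by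
  simp [genPetersen, SimpleGraph.fromRel_adj]

theorem step_uu (n k : ℕ) (i : ZMod n) :
    RW (genPetersen n k) 1 (Sum.inl i) (Sum.inl (i + 1)) := by
  by_cases h : i + 1 = i
  · rw [h]
    exact ⟨SimpleGraph.Walk.nil, by simp⟩
  · apply RW.of_adj
    simp only [genPetersen, SimpleGraph.fromRel_adj]
    refine ⟨?_, by simp⟩
    intro h'
    exact h (Sum.inl.inj h').symm

theorem step_vv (n k : ℕ) (i : ZMod n) :
    RW (genPetersen n k) 1 (Sum.inr i) (Sum.inr (i + (k : ZMod n))) := by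
  by_cases h : i + (k : ZMod n) = i
  · rw [h]
    exact ⟨SimpleGraph.Walk.nil, by simp⟩
  · apply RW.of_adj
    simp only [genPetersen, SimpleGraph.fromRel_adj]
    refine ⟨?_, by simp⟩
    intro h'
    exact h (Sum.inr.inj h').symm

theorem walk_uu_nat (n k : ℕ) (i : ZMod n) (a : ℕ) :
    RW (genPetersen n k) a (Sum.inl i) (Sum.inl (i + (a : ZMod n))) := by
  induction a with
  | zero => simpa using RW.refl _ _
  | succ a ih =>
    have := ih.trans (step_uu n k _)
    rw [add_assoc] at this
    simpa using this

theorem walk_vv_nat (n k : ℕ) (i : ZMod n) (a : ℕ) :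
    RW (genPetersen n k) a (Sum.inr i) (Sum.inr (i + (a : ZMod n) * k)) := by
  induction a with
  | zero => simpa using RW.refl _ _
  | succ a ih =>
    have := ih.trans (step_vv n k _)
    rw [add_assoc] at this
    have e : ((a + 1 : ℕ) : ZMod n) * k = a * k + k := by push_cast; ring
    rw [e]
    exact this

theorem walk_uu (n k : ℕ) (i j : ZMod n) (a : ℤ) (h : (a : ZMod n) = i - j) :
    RW (genPetersen n k) a.natAbs (Sum.inl i) (Sum.inl j) := by
  rcases Int.natAbs_eq a with ha | ha
  · have e : i = j + ((a.natAbs : ℕ) : ZMod n) := by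
      rw [ha] at h
      rw [Int.cast_natCast] at h
      rw [h]; ring
    have := (walk_uu_nat n k j a.natAbs).symm
    rwa [← e] at this
  · have e : j = i + ((a.natAbs : ℕ) : ZMod n) := by
      rw [ha] at h
      rw [Int.cast_neg, Int.cast_natCast] at h
      linear_combination h
    have := (walk_uu_nat n k i a.natAbs)
    rwa [← e] at this

theorem walk_vv (n k : ℕ) (i j : ZMod n) (a : ℤ) (h : (a : ZMod n) * k = i - j) :
    RW (genPetersen n k) a.natAbs (Sum.inr i) (Sum.inr j) := by
  rcases Int.natAbs_eq a with ha | ha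
  · have e : i = j + ((a.natAbs : ℕ) : ZMod n) * k := by
      rw [ha] at h
      rw [Int.cast_natCast] at h
      rw [h]; ring
    have := (walk_vv_nat n k j a.natAbs).symm
    rwa [← e] at this
  · have e : j = i + ((a.natAbs : ℕ) : ZMod n) * k := by
      rw [ha] at h
      rw [Int.cast_neg, Int.cast_natCast] at h
      linear_combination h
    have := (walk_vv_nat n k i a.natAbs)
    rwa [← e] at this

theorem walk_uv (n k : ℕ) (i j : ZMod n) (a b : ℤ)
    (h : (a : ZMod n) + (b : ZMod n) * k = i - j) :
    RW (genPetersen n k) (a.natAbs + b.natAbs + 1) (Sum.inl i) (Sum.inr j) := by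
  have h1 := walk_uu n k i (i - a) a (by ring)
  have h2 := walk_vv n k (i - a) j b (by linear_combination h)
  have h3 := (h1.trans (RW.of_adj (adj_uv n k (i - a)))).trans h2
  obtain ⟨p, hp⟩ := h3
  exact ⟨p, by omega⟩

/-- Word length of `x` with respect to the generators `1` and `k`. -/
noncomputable def F (n k : ℕ) (x : ZMod n) : ℕ :=
  sInf {m | ∃ a b : ℤ, (a : ZMod n) + (b : ZMod n) * k = x ∧ a.natAbs + b.natAbs = m}

theorem F_le (n k : ℕ) (x : ZMod n) (a b : ℤ) (h : (a : ZMod n) + (b : ZMod n) * k = x) :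
    F n k x ≤ a.natAbs + b.natAbs := Nat.sInf_le ⟨a, b, h, rfl⟩

theorem F_spec (n k : ℕ) (x : ZMod n) :
    ∃ a b : ℤ, (a : ZMod n) + (b : ZMod n) * k = x ∧ a.natAbs + b.natAbs = F n k x := by
  obtain ⟨z, hz⟩ := ZMod.intCast_surjective x
  exact Nat.sInf_mem (s := {m | ∃ a b : ℤ, (a : ZMod n) + (b : ZMod n) * k = x ∧
    a.natAbs + b.natAbs = m}) ⟨_, z, 0, by simpa using hz, rfl⟩

theorem F_add (n k : ℕ) (x : ZMod n) : F n k (x + k) ≤ F n k x + 1 := by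
  obtain ⟨a, b, h, e⟩ := F_spec n k x
  have := F_le n k (x + k) a (b + 1) (by push_cast; linear_combination h)
  omega

theorem F_sub (n k : ℕ) (x : ZMod n) : F n k x ≤ F n k (x + k) + 1 := by
  obtain ⟨a, b, h, e⟩ := F_spec n k (x + k)
  have := F_le n k x a (b - 1) (by push_cast; linear_combination h)
  omega

theorem connected (n k : ℕ) : (genPetersen n k).Connected := by
  have key : ∀ w, (genPetersen n k).Reachable w (Sum.inr 0) := by
    have hu : ∀ i, (genPetersen n k).Reachable (Sum.inl i) (Sum.inr 0) := by
      intro i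
      obtain ⟨z, hz⟩ := ZMod.intCast_surjective i
      obtain ⟨p, -⟩ := walk_uv n k i 0 z 0 (by simpa using hz)
      exact ⟨p⟩
    rintro (i | i)
    · exact hu i
    · exact (adj_uv n k i).symm.reachable.trans (hu i)
  have : Nonempty (ZMod n ⊕ ZMod n) := ⟨Sum.inr 0⟩
  exact ⟨fun x y => (key x).trans (key y).symm⟩

/-- What a walk to `u_0` of length `l` certifies about its starting vertex. -/
def Cert (n k : ℕ) (w : ZMod n ⊕ ZMod n) (l : ℕ) : Prop :=
  match w with
  | Sum.inl i => (∃ a : ℤ, (a : ZMod n) = i ∧ a.natAbs ≤ l) ∨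
      (∃ a b : ℤ, (a : ZMod n) + (b : ZMod n) * k = i ∧ a.natAbs + b.natAbs + 2 ≤ l)
  | Sum.inr i => ∃ a b : ℤ, (a : ZMod n) + (b : ZMod n) * k = i ∧ a.natAbs + b.natAbs + 1 ≤ l

theorem cert_step (n k : ℕ) (w w' : ZMod n ⊕ ZMod n) (l : ℕ)
    (h : (genPetersen n k).Adj w w') (hc : Cert n k w' l) : Cert n k w (l + 1) := by
  rw [genPetersen, SimpleGraph.fromRel_adj] at h
  obtain ⟨-, h⟩ := h
  rcases w with i | i <;> rcases w' with j | j <;> simp only [Cert, or_false, false_or] at h hc ⊢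
  · rcases hc with ⟨a, ha, hl⟩ | ⟨a, b, ha, hl⟩
    · left
      rcases h with h | h
      · exact ⟨a - 1, by push_cast; linear_combination ha + h, by omega⟩
      · exact ⟨a + 1, by push_cast; linear_combination ha - h, by omega⟩
    · right
      rcases h with h | h
      · exact ⟨a - 1, b, by push_cast; linear_combination ha + h, by omega⟩
      · exact ⟨a + 1, b, by push_cast; linear_combination ha - h, by omega⟩
  · right
    obtain ⟨a, b, ha, hl⟩ := hc
    exact ⟨a, b, by rw [ha, h], by omega⟩
  · rcases hc with ⟨a, ha, hl⟩ | ⟨a, b, ha, hl⟩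
    · exact ⟨a, 0, by rw [ha, ← h]; simp, by simp; omega⟩
    · exact ⟨a, b, by rw [ha, h], by omega⟩
  · obtain ⟨a, b, ha, hl⟩ := hc
    rcases h with h | h
    · exact ⟨a, b - 1, by push_cast; linear_combination ha + h, by omega⟩
    · exact ⟨a, b + 1, by push_cast; linear_combination ha - h, by omega⟩

theorem cert_walk (n k : ℕ) (w w' : ZMod n ⊕ ZMod n) (p : (genPetersen n k).Walk w w') :
    w' = Sum.inl 0 → Cert n k w p.length := by
  induction p with
  | nil =>
    rintro rfl
    exact Or.inl ⟨0, by simp, by simp⟩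
  | cons h p ih =>
    intro e
    rw [SimpleGraph.Walk.length_cons]
    exact cert_step n k _ _ _ h (ih e)

theorem cert_dist (n k : ℕ) (w : ZMod n ⊕ ZMod n) :
    Cert n k w ((genPetersen n k).dist w (Sum.inl 0)) := by
  obtain ⟨p, hp⟩ := (connected n k).exists_walk_length_eq_dist w (Sum.inl 0)
  rw [← hp]
  exact cert_walk n k w _ p rfl

theorem eq_of_cast (n : ℕ) (x y : ℤ) (h : (x : ZMod n) = y) (hxy : |x - y| < n) : x = y := by
  have h1 : (n : ℤ) ∣ x - y := by
    rw [← ZMod.intCast_zmod_eq_zero_iff_dvd]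
    · push_cast; rw [h]; ring
  have := Int.eq_zero_of_abs_lt_dvd h1 hxy
  omega

/-- In `ℤ` with few wraps, equality modulo `n` of short words is true equality. -/
theorem word_eq (n k M : ℕ) (a b c : ℤ) (d : ℤ)
    (h : (a : ZMod n) + (b : ZMod n) * k = (c : ZMod n) + (d : ZMod n) * k)
    (hb : |a| + |b| * k + |c| + |d| * k ≤ M) (hM : M < n) : a + b * k = c + d * k := by
  apply eq_of_cast n
  · push_cast; exact h
  · have h1 : |a + b * k - (c + d * k)| ≤ |a| + |b| * k + |c| + |d| * k := by
      have e1 : |b * (k : ℤ)| = |b| * k := by rw [abs_mul, Nat.abs_cast]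
      have e2 : |d * (k : ℤ)| = |d| * k := by rw [abs_mul, Nat.abs_cast]
      have e3 := abs_sub (a + b * k) (c + d * k)
      have e4 := abs_add_le a (b * (k : ℤ))
      have e5 := abs_add_le c (d * (k : ℤ))
      linarith
    have : (M : ℤ) < n := by exact_mod_cast hM
    linarith

theorem F_mul (n k : ℕ) (hk : 1 ≤ k) (b : ℤ) (hb : (2 * |b| - 1) * k < n) :
    b.natAbs ≤ F n k ((b : ZMod n) * k) := by
  obtain ⟨a, c, h, e⟩ := F_spec n k ((b : ZMod n) * k)
  rw [← e]
  by_contra! hlt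
  have hlt' : |a| + |c| + 1 ≤ |b| := by
    rw [← Int.natCast_natAbs, ← Int.natCast_natAbs, ← Int.natCast_natAbs]; omega
  have hk' : (1 : ℤ) ≤ k := by exact_mod_cast hk
  have ha := abs_nonneg a
  have hc := abs_nonneg c
  have bd : |a| + |c| * k + |(0 : ℤ)| + |b| * k ≤ (2 * |b| - 1) * k := by
    simp only [abs_zero]
    nlinarith
  have h0 : 0 ≤ (2 * |b| - 1) * (k : ℤ) := by
    apply mul_nonneg <;> omega
  have := word_eq n k ((2 * |b| - 1) * k).toNat a c 0 b (by simpa using h) (by omega) (by omega)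
  have e2 : a = (b - c) * k := by linarith
  have e3 : |a| = |b - c| * k := by rw [e2, abs_mul, Nat.abs_cast]
  have e4 : |b| - |c| ≤ |b - c| := abs_sub_abs_le_abs_sub b c
  nlinarith [abs_nonneg (b - c)]

/-- The exclusion used to bound the loss by one. -/
theorem no_eq (n k h : ℕ) (hk : 6 ≤ k) (hkh : k = 2 * h) (hn : 5 * k ^ 2 + 8 * k < 4 * n)
    (a : ℤ) (h1 : -(h : ℤ) < a) (h2 : a ≤ h) (hF : F n k ((a : ZMod n) + k) = a.natAbs) : False := by
  obtain ⟨c, d, e, e'⟩ := F_spec n k ((a : ZMod n) + k)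
  rw [hF] at e'
  have ta := Int.natCast_natAbs a
  have tc := Int.natCast_natAbs c
  have td := Int.natCast_natAbs d
  have hcd : |c| + |d| = |a| := by omega
  have hah : |a| ≤ h := by omega
  have hc0 := abs_nonneg c
  have hd0 := abs_nonneg d
  have bd : |c| + |d| * k + |a| + |(1 : ℤ)| * k ≤ ((h * k + h + k : ℕ) : ℤ) := by
    push_cast
    rw [abs_one]
    have hk' : (1 : ℤ) ≤ k := by omega
    nlinarith
  have := word_eq n k (h * k + h + k) c d a 1 (by simpa using e) bd (by
    subst hkh; nlinarith)
  have e1 : c - a = (1 - d) * k := by linarith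
  have hd : d = 0 ∨ d = 1 ∨ d = 2 := by
    have : |1 - d| * k ≤ k := by
      rw [← Nat.abs_cast k, ← abs_mul, Nat.abs_cast, ← e1]
      have := abs_sub c a
      omega
    have : |1 - d| ≤ 1 := by
      by_contra! hh
      nlinarith
    rw [abs_le] at this
    omega
  rcases hd with rfl | rfl | rfl <;> omega

theorem F_short (n k : ℕ) (a : ℤ) :
    F n k (a : ZMod n) ≤ a.natAbs ∧ F n k (a : ZMod n) ≤ (a - k).natAbs + 1 ∧
      F n k (a : ZMod n) ≤ (a + k).natAbs + 1 := by
  refine ⟨?_, ?_, ?_⟩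
  · simpa using F_le n k a a 0 (by simp)
  · simpa using F_le n k a (a - k) 1 (by simp)
  · simpa using F_le n k a (a + k) (-1) (by simp)

/-- The vertex sign. -/
noncomputable def sg (n k : ℕ) (w : ZMod n ⊕ ZMod n) : ℤ :=
  Int.sign (((genPetersen n k).dist w (Sum.inl 0) : ℤ) -
    (genPetersen n k).dist w (Sum.inr (-(k : ZMod n))))

theorem dist_u_le (n k : ℕ) (i : ZMod n) :
    (genPetersen n k).dist (Sum.inl i) (Sum.inr (-(k : ZMod n))) ≤ F n k (i + k) + 1 := by
  obtain ⟨a, b, h, e⟩ := F_spec n k (i + k)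
  rw [← e]
  exact (walk_uv n k i _ a b (by rw [h]; ring)).dist_le

theorem dist_v_le (n k : ℕ) (i : ZMod n) :
    (genPetersen n k).dist (Sum.inr i) (Sum.inr (-(k : ZMod n))) ≤ F n k (i + k) + 2 := by
  obtain ⟨a, b, h, e⟩ := F_spec n k (i + k)
  rw [← e]
  have := ((RW.of_adj (adj_uv n k i).symm).trans
    (walk_uv n k i (-(k : ZMod n)) a b (by rw [h]; ring))).dist_le
  omega

theorem le_dist_v (n k : ℕ) (i : ZMod n) :
    F n k i + 1 ≤ (genPetersen n k).dist (Sum.inr i) (Sum.inl 0) := by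
  obtain ⟨a, b, h, e⟩ := cert_dist n k (Sum.inr i)
  have := F_le n k i a b h
  omega

theorem le_dist_u (n k : ℕ) (i : ZMod n) :
    F n k i + 2 ≤ (genPetersen n k).dist (Sum.inl i) (Sum.inl 0) ∨
    ∃ a : ℤ, (a : ZMod n) = i ∧ a.natAbs ≤ (genPetersen n k).dist (Sum.inl i) (Sum.inl 0) := by
  rcases cert_dist n k (Sum.inl i) with h | ⟨a, b, h, e⟩
  · exact Or.inr h
  · left
    have := F_le n k i a b h
    omega

theorem sign_cases (x : ℤ) : (x < 0 ∧ Int.sign x = -1) ∨ (x = 0 ∧ Int.sign x = 0) ∨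
    (0 < x ∧ Int.sign x = 1) := by
  rcases lt_trichotomy x 0 with h | h | h
  · exact Or.inl ⟨h, Int.sign_eq_neg_one_of_neg h⟩
  · exact Or.inr (Or.inl ⟨h, by rw [h]; rfl⟩)
  · exact Or.inr (Or.inr ⟨h, Int.sign_eq_one_of_pos h⟩)

/-- Points `b k` at which inner vertices gain. -/
noncomputable def B (n k : ℕ) (N : ℕ) : Finset (ZMod n) :=
  (Finset.range N).image fun t : ℕ => (((t : ℤ) - ((N - 1) / 2 : ℕ) : ℤ) : ZMod n) * k

theorem B_card (n k N : ℕ) (hk : 1 ≤ k) (hN : ((N : ℤ) - 1) * k < n) : (B n k N).card = N := by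
  rw [B, Finset.card_image_of_injOn, Finset.card_range]
  intro s hs t ht hst
  simp only [Finset.coe_range, Set.mem_Iio] at hs ht
  have h1 : ((((s : ℤ) - ((N - 1) / 2 : ℕ)) * k : ℤ) : ZMod n)
      = ((((t : ℤ) - ((N - 1) / 2 : ℕ)) * k : ℤ) : ZMod n) := by
    push_cast at hst ⊢
    exact hst
  have h2 := eq_of_cast n _ _ h1 (by
    have : ((s : ℤ) - ((N - 1) / 2 : ℕ)) * k - ((t : ℤ) - ((N - 1) / 2 : ℕ)) * k
      = (s - t) * k := by ring
    rw [this, abs_mul, Nat.abs_cast]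
    have : |(s : ℤ) - t| ≤ N - 1 := by rw [abs_le]; omega
    nlinarith)
  have hk' : (k : ℤ) ≠ 0 := by omega
  have := mul_right_cancel₀ hk' h2
  omega

theorem B_mem (n k N : ℕ) (hN : ((N : ℤ) - 1) * k < n) (x : ZMod n)
    (hx : x ∈ B n k N) : ∃ b : ℤ, (2 * |b| - 1) * k < n ∧ x = (b : ZMod n) * k := by
  rw [B, Finset.mem_image] at hx
  obtain ⟨t, ht, rfl⟩ := hx
  rw [Finset.mem_range] at ht
  refine ⟨_, ?_, rfl⟩
  have : 2 * |(t : ℤ) - ((N - 1) / 2 : ℕ)| - 1 ≤ N - 1 := by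
    rw [← Int.natCast_natAbs]
    omega
  nlinarith [Int.natCast_nonneg k]

open Classical in
theorem sg_v (n k N : ℕ) (hk : 1 ≤ k) (hN : ((N : ℤ) - 1) * k < n) (i : ZMod n) :
    Int.sign ((F n k i : ℤ) - F n k (i + k) - 1) + (if i + k ∈ B n k N then 1 else 0)
      ≤ sg n k (Sum.inr i) := by
  have h1 := le_dist_v n k i
  have h2 := dist_v_le n k i
  have h3 := F_add n k i
  have h4 := F_sub n k i
  have s1 := sign_cases ((F n k i : ℤ) - F n k (i + k) - 1)
  have s2 := sign_cases (((genPetersen n k).dist (Sum.inr i) (Sum.inl 0) : ℤ) -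
    (genPetersen n k).dist (Sum.inr i) (Sum.inr (-(k : ZMod n))))
  rw [sg]
  split_ifs with hB
  · obtain ⟨b, hb, e⟩ := B_mem n k N hN _ hB
    have h5 := F_mul n k hk b hb
    rw [← e] at h5
    have h6 := (walk_vv n k i (-(k : ZMod n)) b (by rw [← e]; ring)).dist_le
    omega
  · omega

/-- Points at which outer vertices lose. -/
noncomputable def S (n h : ℕ) : Finset (ZMod n) :=
  (Finset.Icc (-(h : ℤ)) (h + 1)).image fun a : ℤ => (a : ZMod n)

theorem S_card (n h : ℕ) : (S n h).card ≤ 2 * h + 2 := by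
  refine Finset.card_image_le.trans ?_
  rw [Int.card_Icc]
  omega

open Classical in
theorem sg_u (n k h : ℕ) (hk : 6 ≤ k) (hkh : k = 2 * h) (hn : 5 * k ^ 2 + 8 * k < 4 * n)
    (i : ZMod n) :
    Int.sign ((F n k i : ℤ) - F n k (i + k) + 1) - (if i ∈ S n h then 1 else 0)
      - (if i = ((-(h : ℤ) : ℤ) : ZMod n) then 1 else 0) ≤ sg n k (Sum.inl i) := by
  have h2 := dist_u_le n k i
  have h3 := F_add n k i
  have h4 := F_sub n k i
  have s1 := sign_cases ((F n k i : ℤ) - F n k (i + k) + 1)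
  have s2 := sign_cases (((genPetersen n k).dist (Sum.inl i) (Sum.inl 0) : ℤ) -
    (genPetersen n k).dist (Sum.inl i) (Sum.inr (-(k : ZMod n))))
  have l1 : (0 : ℤ) ≤ (if i ∈ S n h then 1 else 0) := by split_ifs <;> simp
  have l2 : (0 : ℤ) ≤ (if i = ((-(h : ℤ) : ℤ) : ZMod n) then 1 else 0) := by
    split_ifs <;> simp
  rw [sg]
  by_cases hd : F n k i + 2 ≤ (genPetersen n k).dist (Sum.inl i) (Sum.inl 0)
  · omega
  obtain ⟨a, ha, hal⟩ := (le_dist_u n k i).resolve_left hd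
  obtain ⟨f1, f2, f3⟩ := F_short n k a
  rw [ha] at f1 f2 f3
  have ha1 : -(h : ℤ) - 1 ≤ a ∧ a ≤ h + 1 := by omega
  by_cases ha2 : a = -(h : ℤ) - 1
  · have f4 := (F_short n k (h - 1)).1
    have e : (((h : ℤ) - 1 : ℤ) : ZMod n) = i + k := by
      rw [← ha, ha2, hkh]
      push_cast
      ring
    rw [e] at f4
    omega
  have hS : i ∈ S n h := by
    rw [S, Finset.mem_image]
    exact ⟨a, by rw [Finset.mem_Icc]; omega, ha⟩
  rw [if_pos hS] at *
  by_cases ha3 : a = -(h : ℤ)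
  · rw [if_pos (by rw [← ha, ha3])] at *
    omega
  have key : a ≤ h → F n k (i + k) ≠ a.natAbs := by
    intro hah hF
    rw [← ha] at hF
    exact no_eq n k h hk hkh hn a (by omega) hah hF
  omega

theorem F_sum (n k : ℕ) [NeZero n] :
    ∑ i : ZMod n, ((F n k i : ℤ) - F n k (i + k)) = 0 := by
  rw [Finset.sum_sub_distrib, sub_eq_zero]
  exact (Equiv.sum_comp (Equiv.addRight (k : ZMod n)) (fun i => (F n k i : ℤ))).symm

theorem sg_sum (n k h N : ℕ) [NeZero n] (hk : 6 ≤ k) (hkh : k = 2 * h)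
    (hn : 5 * k ^ 2 + 8 * k < 4 * n) (hN : ((N : ℤ) - 1) * k < n) :
    (N : ℤ) - (k + 3) ≤ ∑ w, sg n k w := by
  classical
  rw [Fintype.sum_sum_type, ← Finset.sum_add_distrib]
  have h1 : ∀ i : ZMod n, ((F n k i : ℤ) - F n k (i + k)) + (if i + k ∈ B n k N then 1 else 0)
      - (if i ∈ S n h then 1 else 0) - (if i = ((-(h : ℤ) : ℤ) : ZMod n) then 1 else 0)
      ≤ sg n k (Sum.inl i) + sg n k (Sum.inr i) := by
    intro i
    have a1 := sg_u n k h hk hkh hn i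
    have a2 := sg_v n k N (by omega) hN i
    have h3 := F_add n k i
    have h4 := F_sub n k i
    have s1 := sign_cases ((F n k i : ℤ) - F n k (i + k) + 1)
    have s2 := sign_cases ((F n k i : ℤ) - F n k (i + k) - 1)
    have s3 : Int.sign ((F n k i : ℤ) - F n k (i + k) + 1) +
      Int.sign ((F n k i : ℤ) - F n k (i + k) - 1) = (F n k i : ℤ) - F n k (i + k) := by omega
    linarith
  refine le_trans ?_ (Finset.sum_le_sum fun i _ => h1 i)
  rw [Finset.sum_sub_distrib, Finset.sum_sub_distrib, Finset.sum_add_distrib, F_sum]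
  have e1 : ∑ i : ZMod n, (if i + k ∈ B n k N then (1 : ℤ) else 0) = N := by
    refine (Equiv.sum_comp (Equiv.addRight (k : ZMod n))
      (fun i => if i ∈ B n k N then (1 : ℤ) else 0)).trans ?_
    simp [B_card n k N (by omega) hN]
  have e2 : ∑ i : ZMod n, (if i ∈ S n h then (1 : ℤ) else 0) ≤ 2 * h + 2 := by
    simp only [Finset.sum_ite_mem, Finset.univ_inter, Finset.sum_const, nsmul_eq_mul, mul_one]
    exact_mod_cast S_card n h
  have e3 : ∑ i : ZMod n, (if i = ((-(h : ℤ) : ℤ) : ZMod n) then (1 : ℤ) else 0) = 1 := by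
    simp
  rw [e1, e3]
  have : (k : ℤ) = 2 * h := by exact_mod_cast hkh
  linarith

theorem count (n k : ℕ) [NeZero n] :
    (2 * ((closerSet (genPetersen n k) (Sum.inr (-(k : ZMod n))) (Sum.inl 0)).ncard : ℤ)
      + (eqDistSet (genPetersen n k) (Sum.inl 0) (Sum.inr (-(k : ZMod n)))).ncard)
      = 2 * n + ∑ w, sg n k w := by
  classical
  have hc : ∀ s : Set (ZMod n ⊕ ZMod n), (s.ncard : ℤ) = ∑ w, if w ∈ s then 1 else 0 := by
    intro s
    rw [Set.ncard_eq_toFinset_card']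
    simp
  have hV : (2 * n : ℤ) = ∑ w : ZMod n ⊕ ZMod n, 1 := by
    simp [ZMod.card]
    ring
  rw [hc, hc, hV, Finset.mul_sum, ← Finset.sum_add_distrib, ← Finset.sum_add_distrib]
  refine Finset.sum_congr rfl fun w _ => ?_
  rw [sg]
  simp only [closerSet, eqDistSet, Set.mem_ofPred_eq]
  have s2 := sign_cases (((genPetersen n k).dist w (Sum.inl 0) : ℤ) -
    (genPetersen n k).dist w (Sum.inr (-(k : ZMod n))))
  split_ifs <;> omega

theorem dist_two (n k : ℕ) (hk : 1 ≤ k) (hkn : k < n) :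
    (genPetersen n k).dist (Sum.inl 0) (Sum.inr (-(k : ZMod n))) = 2 := by
  have hk0 : (k : ZMod n) ≠ 0 := by
    intro h0
    rw [ZMod.natCast_eq_zero_iff] at h0
    exact absurd (Nat.le_of_dvd (by omega) h0) (by omega)
  have h1 := (walk_uv n k 0 (-(k : ZMod n)) 0 1 (by simp)).dist_le
  have h2 : (genPetersen n k).dist (Sum.inl 0) (Sum.inr (-(k : ZMod n))) ≠ 0 := by
    rw [Ne, (connected n k).dist_eq_zero_iff]
    simp
  have h3 : (genPetersen n k).dist (Sum.inl 0) (Sum.inr (-(k : ZMod n))) ≠ 1 := by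
    rw [Ne, SimpleGraph.dist_eq_one_iff_adj]
    intro h
    simp only [genPetersen, SimpleGraph.fromRel_adj, or_false] at h
    exact hk0 (by simpa using h.2)
  simp at h1
  omega

end GPaux

theorem stmt_18 (n k : ℕ) (hk : 6 ≤ k) (hke : Even k)
    (hn : 5 * k ^ 2 + 8 * k < 4 * n) :
    (genPetersen n k).dist (Sum.inl 0) (Sum.inr (((n - k : ℕ) : ZMod n))) = 2 ∧
    ((2 * (closerSet (genPetersen n k) (Sum.inr (((n - k : ℕ) : ZMod n))) (Sum.inl 0)).ncard
        + (eqDistSet (genPetersen n k) (Sum.inl 0) (Sum.inr (((n - k : ℕ) : ZMod n)))).ncard : ℚ)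
      ≥ 2 * (n : ℚ) + (n : ℚ) / k - (5 / 4) * k - 2) ∧
    (2 * (n : ℚ) + (n : ℚ) / k - (5 / 4) * k - 2 > 2 * (n : ℚ)) := by
  obtain ⟨h, hkh⟩ := hke
  have hkn : k < n := by nlinarith
  have : NeZero n := ⟨by omega⟩
  have hcast : ((n - k : ℕ) : ZMod n) = -(k : ZMod n) := by
    rw [Nat.cast_sub hkn.le]
    simp
  rw [hcast]
  have hkq : (6 : ℚ) ≤ k := by exact_mod_cast hk
  have hk0 : (0 : ℚ) < k := by linarith
  refine ⟨GPaux.dist_two n k (by omega) hkn, ?_, ?_⟩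
  · obtain ⟨N, hN1, hN2⟩ : ∃ N : ℕ, ((N : ℤ) - 1) * k < n ∧ n ≤ N * k := by
      refine ⟨(n - 1) / k + 1, ?_, ?_⟩
      · have := Nat.div_mul_le_self (n - 1) k
        have h2 : (n - 1) / k * k < n := by omega
        push_cast
        rw [add_sub_cancel_right]
        exact_mod_cast h2
      · have := Nat.lt_div_mul_add (a := n - 1) (b := k) (by omega)
        rw [add_mul]
        omega
    have h1 := GPaux.sg_sum n k h N hk (by omega) hn hN1
    have h2 := GPaux.count n k
    have h3 : (n : ℚ) / k ≤ N := by
      rw [div_le_iff₀ hk0]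
      exact_mod_cast hN2
    have h4 : (2 * (n : ℤ) + (N - (k + 3))) ≤
      (2 * ((closerSet (genPetersen n k) (Sum.inr (-(k : ZMod n))) (Sum.inl 0)).ncard : ℤ)
      + (eqDistSet (genPetersen n k) (Sum.inl 0) (Sum.inr (-(k : ZMod n)))).ncard) := by
      linarith
    have h5 : (2 * (n : ℚ) + (N - (k + 3))) ≤
      (2 * ((closerSet (genPetersen n k) (Sum.inr (-(k : ZMod n))) (Sum.inl 0)).ncard : ℚ)
      + (eqDistSet (genPetersen n k) (Sum.inl 0) (Sum.inr (-(k : ZMod n)))).ncard) := by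
      exact_mod_cast h4
    linarith
  · have h3 : (5 / 4) * (k : ℚ) + 2 < (n : ℚ) / k := by
      rw [lt_div_iff₀ hk0]
      have : (5 * (k : ℚ) ^ 2 + 8 * k) < 4 * n := by exact_mod_cast hn
      nlinarith
    linarith
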